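/- arXiv:1701.03967 — 2 statements merged into one kernel-verified Lean document; each statement's English description precedes it below -/
import Mathlib

section
/- Let G̃ be a bisymmetric invertible (n−1)×(n−1) real matrix, g_0, g_n ∈ ℝ, g ∈ ℝ^{n−1}, ǧ := P g. If a mesh vector v satisfies the FEM eigen-equations (II), then v_{j−1/2} = −G̃^{−1}(v_{j−1} g + v_j ǧ) for j = 1,…,K; if v additionally satisfies equations (I), then its node values satisfy the three-point equations ĝ_n v_{j−1} + 2 ĝ_0 v_j + ĝ_n v_{j+1} = 0 for j = 1,…,K−1, where ĝ_0 := g_0 − g·G̃^{−1} g and ĝ_n := g_n − ǧ·G̃^{−1} g. -/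
open Matrix

/-- The reversal operator on ℝ^m. -/
def revVec (m : ℕ) (p : Fin m → ℝ) : Fin m → ℝ := fun i => p i.rev

/-- A matrix is bisymmetric if it is symmetric w.r.t. the main and
secondary diagonals. -/
def Bisym {m : ℕ} (B : Matrix (Fin m) (Fin m) ℝ) : Prop :=
  (∀ i j, B i j = B j i) ∧ (∀ i j, B i j = B j.rev i.rev)

lemma revVec_dotProduct_revVec {m : ℕ} (x y : Fin m → ℝ) :
    revVec m x ⬝ᵥ revVec m y = x ⬝ᵥ y :=
  Equiv.sum_comp Fin.revPerm fun i => x i * y i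

lemma revVec_revVec {m : ℕ} (x : Fin m → ℝ) : revVec m (revVec m x) = x := by
  funext i
  simp [revVec]

lemma Bisym.mulVec_revVec {m : ℕ} {B : Matrix (Fin m) (Fin m) ℝ} (hB : Bisym B)
    (x : Fin m → ℝ) : B.mulVec (revVec m x) = revVec m (B.mulVec x) := by
  funext i
  have hrow : B i = revVec m (B i.rev) := by
    funext j
    rw [revVec, hB.2 i j, hB.1]
  change B i ⬝ᵥ revVec m x = B i.rev ⬝ᵥ x
  rw [hrow, revVec_dotProduct_revVec]

lemma Bisym.inv_mulVec_revVec {m : ℕ} {B : Matrix (Fin m) (Fin m) ℝ} (hB : Bisym B)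
    (hdet : IsUnit B.det) (x : Fin m → ℝ) :
    B⁻¹.mulVec (revVec m x) = revVec m (B⁻¹.mulVec x) := by
  have h : B.mulVec (revVec m (B⁻¹.mulVec x)) = revVec m x := by
    rw [hB.mulVec_revVec, mulVec_mulVec, mul_nonsing_inv _ hdet, one_mulVec]
  rw [← h, mulVec_mulVec, nonsing_inv_mul _ hdet, one_mulVec]

/-- elimination of element values from equation (II), and the
resulting three-point equations for the node values when (I) also holds. -/
theorem elimination_and_three_point_equations
    (n K : ℕ) (hn : 2 ≤ n) (hK : 2 ≤ K)
    (Gt : Matrix (Fin (n-1)) (Fin (n-1)) ℝ) (hGt : Bisym Gt)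
    (hGdet : IsUnit Gt.det)
    (g0 gn : ℝ) (g : Fin (n-1) → ℝ)
    (vN : ℕ → ℝ) (vE : ℕ → Fin (n-1) → ℝ)
    (hv0 : vN 0 = 0) (hvK : vN K = 0)
    (hII : ∀ j, 1 ≤ j → j ≤ K →
      vN (j-1) • g + Gt.mulVec (vE j) + vN j • revVec (n-1) g = 0) :
    (∀ j, 1 ≤ j → j ≤ K →
      vE j = -(Gt⁻¹.mulVec (vN (j-1) • g + vN j • revVec (n-1) g))) ∧
    ((∀ j, 1 ≤ j → j ≤ K - 1 →
        gn * vN (j-1) + revVec (n-1) g ⬝ᵥ vE j + 2 * g0 * vN j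
          + g ⬝ᵥ vE (j+1) + gn * vN (j+1) = 0) →
      ∀ j, 1 ≤ j → j ≤ K - 1 →
        (gn - revVec (n-1) g ⬝ᵥ Gt⁻¹.mulVec g) * vN (j-1)
          + 2 * (g0 - g ⬝ᵥ Gt⁻¹.mulVec g) * vN j
          + (gn - revVec (n-1) g ⬝ᵥ Gt⁻¹.mulVec g) * vN (j+1) = 0) := by
  have helim : ∀ j, 1 ≤ j → j ≤ K →
      vE j = -(Gt⁻¹.mulVec (vN (j-1) • g + vN j • revVec (n-1) g)) := by
    intro j h1 hj
    have h : vN (j-1) • g + vN j • revVec (n-1) g = -(Gt.mulVec (vE j)) := by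
      rw [eq_neg_iff_add_eq_zero, ← hII j h1 hj]
      abel
    rw [h, mulVec_neg, neg_neg, mulVec_mulVec, nonsing_inv_mul _ hGdet, one_mulVec]
  refine ⟨helim, fun hI j h1 hj => ?_⟩
  have hdiag : revVec (n-1) g ⬝ᵥ revVec (n-1) (Gt⁻¹.mulVec g) = g ⬝ᵥ Gt⁻¹.mulVec g :=
    revVec_dotProduct_revVec _ _
  have hoff : g ⬝ᵥ revVec (n-1) (Gt⁻¹.mulVec g) = revVec (n-1) g ⬝ᵥ Gt⁻¹.mulVec g := by
    rw [← revVec_dotProduct_revVec, revVec_revVec]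
  have h := hI j h1 hj
  rw [helim j h1 (by omega), helim (j+1) (by omega) (by omega)] at h
  simp only [Nat.add_sub_cancel, mulVec_add, mulVec_smul, hGt.inv_mulVec_revVec hGdet,
    dotProduct_neg, dotProduct_add, dotProduct_smul, smul_eq_mul, hdiag, hoff] at h
  linear_combination h
end

section
/- Let C̃ be a bisymmetric (n−1)×(n−1) real matrix, c_0, c_n ∈ ℝ, c ∈ ℝ^{n−1}, č := P c. Let e ∈ ℝ^{n−1} be either even or odd, and let s_0[e] be the mesh vector with node values 0 and element values (−P)^{j−1} e, j = 1,…,K. Let q ∈ ℝ^{n−1} and let w be any mesh vector whose element values satisfy w_{j−1/2} = w_{j−1} q + w_j q̌ for j = 1,…,K. Then (C s_0[e], w) = 0. -/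
open Matrix

/-- The operator −P (negated reversal). -/
def negRev (m : ℕ) (p : Fin m → ℝ) : Fin m → ℝ := -(revVec m p)

/-- The C-bilinear form (Cv, w) of mesh vectors: node values vN, wN : ℕ → ℝ
(relevant for indices 0,…,K) and element values vE, wE (vE j corresponds to
v_{j−1/2}, j = 1,…,K). -/
def Cform (n K : ℕ) (Ct : Matrix (Fin (n-1)) (Fin (n-1)) ℝ) (c0 cn : ℝ)
    (c : Fin (n-1) → ℝ) (vN : ℕ → ℝ) (vE : ℕ → Fin (n-1) → ℝ)
    (wN : ℕ → ℝ) (wE : ℕ → Fin (n-1) → ℝ) : ℝ :=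
  (∑ j ∈ Finset.Icc 1 (K-1),
      (2 * c0 * vN j + cn * (vN (j-1) + vN (j+1))
        + revVec (n-1) c ⬝ᵥ vE j + c ⬝ᵥ vE (j+1)) * wN j)
  + ∑ j ∈ Finset.Icc 1 K,
      (vN (j-1) • c + Ct.mulVec (vE j) + vN j • revVec (n-1) c) ⬝ᵥ wE j

theorem revVec_dotProduct (m : ℕ) (p r : Fin m → ℝ) :
    revVec m p ⬝ᵥ r = p ⬝ᵥ revVec m r := by
  simp only [dotProduct, revVec]
  exact Fintype.sum_equiv Fin.revPerm _ _ fun i => by simp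

theorem Bisym.revVec_mulVec {m : ℕ} {B : Matrix (Fin m) (Fin m) ℝ} (hB : Bisym B)
    (p : Fin m → ℝ) : revVec m (B *ᵥ p) = B *ᵥ revVec m p := by
  ext i
  simp only [mulVec, dotProduct, revVec]
  refine Fintype.sum_equiv Fin.revPerm _ _ fun j => ?_
  have h : B i.rev j = B i j.rev := by
    rw [hB.2 i.rev j, Fin.rev_rev, hB.1]
  simp [h]

theorem sum_Icc_pred_sub (g : ℕ → ℝ) (K : ℕ) :
    ∑ j ∈ Finset.Icc 1 K, (g (j - 1) - g j) = g 0 - g K := by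
  induction K with
  | zero => simp
  | succ k ih => rw [Finset.sum_Icc_succ_top (by omega), ih]; simp

/-- (C s₀[e], w) = 0 for e even or odd and any mesh vector w of
the interpolation form w_{j−1/2} = w_{j−1} q + w_j q̌. -/
theorem Cform_s0_orthogonal
    (n K : ℕ) (hn : 2 ≤ n) (hK : 2 ≤ K)
    (Ct : Matrix (Fin (n-1)) (Fin (n-1)) ℝ) (hCt : Bisym Ct)
    (c0 cn : ℝ) (c : Fin (n-1) → ℝ)
    (e : Fin (n-1) → ℝ)
    (heo : revVec (n-1) e = e ∨ revVec (n-1) e = -e)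
    (q : Fin (n-1) → ℝ)
    (wN : ℕ → ℝ) (wE : ℕ → Fin (n-1) → ℝ)
    (hw0 : wN 0 = 0) (hwK : wN K = 0)
    (hwE : ∀ j, 1 ≤ j → j ≤ K → wE j = wN (j-1) • q + wN j • revVec (n-1) q) :
    Cform n K Ct c0 cn c (fun _ => 0) (fun j => (negRev (n-1))^[j-1] e) wN wE
      = 0 := by
  have hnode : ∀ j ∈ Finset.Icc 1 (K - 1),
      (2 * c0 * 0 + cn * (0 + 0) + revVec (n-1) c ⬝ᵥ (negRev (n-1))^[j-1] e
        + c ⬝ᵥ (negRev (n-1))^[j+1-1] e) * wN j = 0 := by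
    intro j hj
    obtain ⟨k, rfl⟩ := Nat.exists_eq_add_of_le' (Finset.mem_Icc.mp hj).1
    simp only [Nat.add_sub_cancel, Function.iterate_succ_apply', revVec_dotProduct]
    simp [negRev]
  have helt : ∀ j ∈ Finset.Icc 1 K,
      ((0 : ℝ) • c + Ct *ᵥ (negRev (n-1))^[j-1] e + (0 : ℝ) • revVec (n-1) c) ⬝ᵥ wE j
        = wN (j-1) * (Ct *ᵥ (negRev (n-1))^[j-1] e ⬝ᵥ q)
          - wN j * (Ct *ᵥ (negRev (n-1))^[j] e ⬝ᵥ q) := by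
    intro j hj
    obtain ⟨hj1, hjK⟩ := Finset.mem_Icc.mp hj
    rw [hwE j hj1 hjK]
    obtain ⟨k, rfl⟩ := Nat.exists_eq_add_of_le' hj1
    simp only [Nat.add_sub_cancel, Function.iterate_succ_apply', zero_smul, zero_add, add_zero,
      dotProduct_add, dotProduct_smul, smul_eq_mul, ← revVec_dotProduct, hCt.revVec_mulVec]
    simp [negRev, mulVec_neg]
  rw [Cform, Finset.sum_eq_zero hnode, Finset.sum_congr rfl helt, zero_add]
  rw [sum_Icc_pred_sub fun j => wN j * (Ct *ᵥ (negRev (n-1))^[j] e ⬝ᵥ q), hw0, hwK]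
  simp
end
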